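/- Let 𝒮 be an arbitrary collection of nondegenerate triangles in ℝ². Then the following are equivalent: (i) there exists γ₀ > 0 such that H_{T₀}/h_{T₀} ≤ γ₀ for every T₀ ∈ 𝒮; (ii) there exists γ₂ with 0 < γ₂ < π such that θ_{T₀,max} ≤ γ₂ for every T₀ ∈ 𝒮 (the maximum-angle condition). Here h_{T₀} := diam(T₀), H_{T₀} := (h_{T₀}²/|T₀|)·min_{1≤i≤3}|L_i|, and θ_{T₀,max} denotes the maximum of the three interior angles of T₀. -/

import Mathlib

open MeasureTheory EuclideanGeometry

noncomputable section

/-- The reference triangle with vertices `0`, `e₀`, `e₁`. -/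
def referenceTriangle : Set (EuclideanSpace ℝ (Fin 2)) :=
  {x | 0 ≤ x 0 ∧ 0 ≤ x 1 ∧ x 0 + x 1 ≤ 1}

theorem volume_triangle_prod :
    volume {z : ℝ × ℝ | 0 ≤ z.1 ∧ 0 ≤ z.2 ∧ z.1 + z.2 ≤ 1} = ENNReal.ofReal (1 / 2) := by
  have hm : MeasurableSet {z : ℝ × ℝ | 0 ≤ z.1 ∧ 0 ≤ z.2 ∧ z.1 + z.2 ≤ 1} := by
    measurability
  have hslice : ∀ x : ℝ,
      volume (Prod.mk x ⁻¹' {z : ℝ × ℝ | 0 ≤ z.1 ∧ 0 ≤ z.2 ∧ z.1 + z.2 ≤ 1}) =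
        (Set.Icc (0 : ℝ) 1).indicator (fun x => ENNReal.ofReal (1 - x)) x := by
    intro x
    by_cases hx : x ∈ Set.Icc (0 : ℝ) 1
    · have : Prod.mk x ⁻¹' {z : ℝ × ℝ | 0 ≤ z.1 ∧ 0 ≤ z.2 ∧ z.1 + z.2 ≤ 1} =
          Set.Icc 0 (1 - x) := by
        ext t
        simp only [Set.mem_preimage, Set.mem_ofPred_eq, Set.mem_Icc]
        exact ⟨fun h => ⟨h.2.1, by linarith [h.2.2]⟩, fun h => ⟨hx.1, h.1, by linarith [h.2]⟩⟩
      rw [this, Real.volume_Icc, Set.indicator_of_mem hx, sub_zero]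
    · have : Prod.mk x ⁻¹' {z : ℝ × ℝ | 0 ≤ z.1 ∧ 0 ≤ z.2 ∧ z.1 + z.2 ≤ 1} = ∅ := by
        ext t
        simp only [Set.mem_preimage, Set.mem_ofPred_eq, Set.mem_empty_iff_false, iff_false]
        exact fun h => hx ⟨h.1, by linarith [h.2.1, h.2.2]⟩
      rw [this, measure_empty, Set.indicator_of_notMem hx]
  rw [Measure.volume_eq_prod, Measure.prod_apply hm]
  simp_rw [hslice]
  rw [lintegral_indicator measurableSet_Icc, ← ofReal_integral_eq_lintegral_ofReal]
  · rw [integral_Icc_eq_integral_Ioc, ← intervalIntegral.integral_of_le zero_le_one]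
    congr 1
    rw [intervalIntegral.integral_sub intervalIntegrable_const intervalIntegral.intervalIntegrable_id,
      integral_id, intervalIntegral.integral_const]
    norm_num
  · exact (by fun_prop : Continuous fun x : ℝ => 1 - x).integrableOn_Icc
  · filter_upwards [ae_restrict_mem measurableSet_Icc] with x hx
    simpa using hx.2

theorem volume_referenceTriangle : volume referenceTriangle = ENNReal.ofReal (1 / 2) := by
  rw [← volume_triangle_prod,
    ← ((volume_preserving_finTwoArrow ℝ).comp
      (PiLp.volume_preserving_ofLp (Fin 2))).measure_preimage
      (MeasurableSet.nullMeasurableSet (by measurability))]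
  rfl

/-- The linear map sending the standard basis of the plane to `u`, `v`. -/
def linearMapOfPair (u v : EuclideanSpace ℝ (Fin 2)) :
    EuclideanSpace ℝ (Fin 2) →ₗ[ℝ] EuclideanSpace ℝ (Fin 2) where
  toFun x := x 0 • u + x 1 • v
  map_add' x y := by simp only [PiLp.add_apply]; module
  map_smul' c x := by simp only [PiLp.smul_apply, smul_eq_mul, RingHom.id_apply]; module

theorem det_linearMapOfPair (u v : EuclideanSpace ℝ (Fin 2)) :
    LinearMap.det (linearMapOfPair u v) = u 0 * v 1 - u 1 * v 0 := by
  rw [← LinearMap.det_toMatrix (EuclideanSpace.basisFun (Fin 2) ℝ).toBasis, Matrix.det_fin_two]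
  simp [LinearMap.toMatrix_apply, linearMapOfPair]
  ring

theorem abs_det_linearMapOfPair (u v : EuclideanSpace ℝ (Fin 2)) :
    |LinearMap.det (linearMapOfPair u v)| =
      Real.sin (InnerProductGeometry.angle u v) * (‖u‖ * ‖v‖) := by
  rw [det_linearMapOfPair, InnerProductGeometry.sin_angle_mul_norm_mul_norm, ← Real.sqrt_sq_eq_abs]
  congr 1
  simp only [PiLp.inner_apply, Fin.sum_univ_two, RCLike.inner_apply, conj_trivial]
  ring

theorem convexHull_triple_eq_image (p q r : EuclideanSpace ℝ (Fin 2)) :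
    convexHull ℝ {p, q, r} =
      (fun x => p + x) '' (linearMapOfPair (q - p) (r - p) '' referenceTriangle) := by
  rw [Set.image_image]
  apply Set.Subset.antisymm
  · refine convexHull_min ?_ ?_
    · rintro x (rfl | rfl | rfl)
      · exact ⟨0, by simp [referenceTriangle], by simp⟩
      · exact ⟨!₂[1, 0], by simp [referenceTriangle], by simp [linearMapOfPair]⟩
      · exact ⟨!₂[0, 1], by simp [referenceTriangle], by simp [linearMapOfPair]⟩
    · have hc : Convex ℝ referenceTriangle := by
        rintro x ⟨hx0, hx1, hx⟩ y ⟨hy0, hy1, hy⟩ a b ha hb hab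
        simp only [referenceTriangle, Set.mem_ofPred_eq, PiLp.add_apply, PiLp.smul_apply,
          smul_eq_mul]
        refine ⟨by positivity, by positivity, ?_⟩
        nlinarith [mul_le_mul_of_nonneg_left hx ha, mul_le_mul_of_nonneg_left hy hb]
      simpa only [Set.image_image] using
        (hc.linear_image (linearMapOfPair (q - p) (r - p))).translate p
  · rintro _ ⟨x, ⟨hx0, hx1, hx⟩, rfl⟩
    have h := (convex_convexHull ℝ {p, q, r}).sum_mem (t := Finset.univ)
      (w := ![1 - x 0 - x 1, x 0, x 1]) (z := ![p, q, r])
      (by intro i _; fin_cases i <;> simp <;> linarith)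
      (by simp only [Fin.sum_univ_three, Matrix.cons_val]; ring)
      (by intro i _; apply subset_convexHull; fin_cases i <;> simp)
    convert h using 1
    simp only [linearMapOfPair, LinearMap.coe_mk, AddHom.coe_mk, Fin.sum_univ_three,
      Matrix.cons_val]
    module

theorem volume_convexHull_triple (p q r : EuclideanSpace ℝ (Fin 2)) :
    (volume (convexHull ℝ {p, q, r})).toReal =
      dist p q * dist p r * Real.sin (∠ q p r) / 2 := by
  have hs := InnerProductGeometry.sin_angle_nonneg (q - p) (r - p)
  rw [convexHull_triple_eq_image, Set.image_add_left, measure_preimage_add,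
    Measure.addHaar_image_linearMap, volume_referenceTriangle, abs_det_linearMapOfPair,
    ← ENNReal.ofReal_mul (by positivity), ENNReal.toReal_ofReal (by positivity),
    dist_comm p q, dist_comm p r, dist_eq_norm, dist_eq_norm]
  simp only [EuclideanGeometry.angle, vsub_eq_sub]
  ring

/-- The quotient `H/h` of the triangle with vertices `p`, `q`, `r`. -/
def semiRegularityRatio (p q r : EuclideanSpace ℝ (Fin 2)) : ℝ :=
  (Metric.diam (convexHull ℝ {p, q, r}) ^ 2 / (volume (convexHull ℝ {p, q, r})).toReal *
    min (min (dist p q) (dist p r)) (dist q r)) / Metric.diam (convexHull ℝ {p, q, r})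

/-- The largest angle of the triangle with vertices `p`, `q`, `r`. -/
def maxAngle (p q r : EuclideanSpace ℝ (Fin 2)) : ℝ :=
  max (max (∠ q p r) (∠ p q r)) (∠ p r q)

theorem semiRegularityRatio_swap_left (p q r : EuclideanSpace ℝ (Fin 2)) :
    semiRegularityRatio p q r = semiRegularityRatio q p r := by
  unfold semiRegularityRatio
  rw [Set.insert_comm p q, dist_comm p q, min_right_comm]

theorem semiRegularityRatio_swap_right (p q r : EuclideanSpace ℝ (Fin 2)) :
    semiRegularityRatio p q r = semiRegularityRatio p r q := by
  unfold semiRegularityRatio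
  rw [Set.pair_comm q r, dist_comm q r, min_comm (dist p q)]

theorem maxAngle_swap_left (p q r : EuclideanSpace ℝ (Fin 2)) :
    maxAngle p q r = maxAngle q p r := by
  unfold maxAngle
  rw [max_comm (∠ q p r), angle_comm p r q]

theorem maxAngle_swap_right (p q r : EuclideanSpace ℝ (Fin 2)) :
    maxAngle p q r = maxAngle p r q := by
  unfold maxAngle
  rw [max_right_comm, angle_comm q p r]

/-- Two-sided bounds on `H/h` in terms of the largest angle, for vertices listed so that the edge
lengths increase. -/
theorem semiRegularityRatio_maxAngle_bounds_of_sorted {p q r : EuclideanSpace ℝ (Fin 2)}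
    (h : ¬Collinear ℝ {p, q, r}) (hab : dist p q ≤ dist p r) (hbc : dist p r ≤ dist q r) :
    Real.pi / 3 ≤ maxAngle p q r ∧ maxAngle p q r < Real.pi ∧
      2 / Real.sin (maxAngle p q r) ≤ semiRegularityRatio p q r ∧
      semiRegularityRatio p q r ≤ 4 / Real.sin (maxAngle p q r) := by
  have hpq : 0 < dist p q := dist_pos.2 (ne₁₂_of_not_collinear h)
  have hpr : 0 < dist p r := hpq.trans_le hab
  have hqr : 0 < dist q r := hpr.trans_le hbc
  have hqpr : ¬Collinear ℝ {q, p, r} := by rwa [Set.insert_comm]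
  have hqp : ∠ p q r ≤ ∠ q p r := by
    rw [angle_comm p q r, angle_comm q p r,
      angle_le_iff_dist_le (by rwa [Set.insert_comm, Set.pair_comm r q])]
    rwa [dist_comm r p, dist_comm r q]
  have hrp : ∠ p r q ≤ ∠ q p r := by
    rw [angle_comm p r q, angle_le_iff_dist_le hqpr, dist_comm q p]
    exact hab.trans hbc
  have hmax : maxAngle p q r = ∠ q p r := by
    rw [maxAngle, max_eq_left hqp, max_eq_left hrp]
  have hsum := angle_add_angle_add_angle_eq_pi r (ne₁₂_of_not_collinear h).symm
  have hlt : ∠ q p r < Real.pi := (angle_lt_pi_of_not_collinear hqpr)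
  have hpos : 0 < ∠ q p r := (angle_pos_of_not_collinear hqpr)
  have hsin := Real.sin_pos_of_pos_of_lt_pi hpos hlt
  have hratio : semiRegularityRatio p q r =
      2 * dist q r / (dist p r * Real.sin (∠ q p r)) := by
    rw [semiRegularityRatio, volume_convexHull_triple, convexHull_diam, Metric.diam_triple,
      max_eq_right hab, max_eq_right hbc, min_eq_left hab, min_eq_left (hab.trans hbc)]
    field_simp
  rw [hmax, hratio]
  refine ⟨?_, hlt, ?_, ?_⟩
  · rw [angle_comm r p q] at hsum
    linarith [angle_comm q r p]
  · rw [div_le_div_iff₀ hsin (by positivity)]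
    nlinarith [mul_le_mul_of_nonneg_left hbc hsin.le]
  · rw [div_le_div_iff₀ (by positivity) hsin]
    have htri := dist_triangle q p r
    rw [dist_comm q p] at htri
    nlinarith [mul_le_mul_of_nonneg_left (show dist q r ≤ 2 * dist p r by linarith) hsin.le]

theorem semiRegularityRatio_maxAngle_bounds {p q r : EuclideanSpace ℝ (Fin 2)}
    (h : ¬Collinear ℝ {p, q, r}) :
    Real.pi / 3 ≤ maxAngle p q r ∧ maxAngle p q r < Real.pi ∧
      2 / Real.sin (maxAngle p q r) ≤ semiRegularityRatio p q r ∧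
      semiRegularityRatio p q r ≤ 4 / Real.sin (maxAngle p q r) := by
  wlog hab : dist p q ≤ dist p r generalizing p q r
  · rw [maxAngle_swap_right, semiRegularityRatio_swap_right]
    exact this (by rwa [Set.pair_comm]) (le_of_not_ge hab)
  by_cases hac : dist p q ≤ dist q r
  · by_cases hbc : dist p r ≤ dist q r
    · exact semiRegularityRatio_maxAngle_bounds_of_sorted h hab hbc
    · rw [maxAngle_swap_left, semiRegularityRatio_swap_left]
      exact semiRegularityRatio_maxAngle_bounds_of_sorted (by rwa [Set.insert_comm])
        (by rwa [dist_comm q p]) (le_of_not_ge hbc)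
  · rw [maxAngle_swap_left, maxAngle_swap_right, semiRegularityRatio_swap_left,
      semiRegularityRatio_swap_right]
    refine semiRegularityRatio_maxAngle_bounds_of_sorted ?_ ?_ ?_
    · rwa [Set.pair_comm r p, Set.insert_comm]
    · rw [dist_comm q p]
      exact le_of_not_ge hac
    · rwa [dist_comm q p, dist_comm r p]

/-- For a family of nondegenerate triangles in the plane, the condition
`H_{T₀}/h_{T₀} ≤ γ₀` is equivalent to the maximum-angle condition. -/
theorem stmt_3
    (𝒮 : Set (Fin 3 → EuclideanSpace ℝ (Fin 2)))
    (h𝒮 : ∀ y ∈ 𝒮, AffineIndependent ℝ y) :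
    (∃ γ₀ > (0 : ℝ), ∀ y ∈ 𝒮,
      ((Metric.diam (convexHull ℝ (Set.range y))) ^ 2 /
            (volume (convexHull ℝ (Set.range y))).toReal *
          min (min (dist (y 0) (y 1)) (dist (y 0) (y 2))) (dist (y 1) (y 2))) /
        Metric.diam (convexHull ℝ (Set.range y)) ≤ γ₀) ↔
    (∃ γ₂ : ℝ, 0 < γ₂ ∧ γ₂ < Real.pi ∧ ∀ y ∈ 𝒮,
      max (max (EuclideanGeometry.angle (y 1) (y 0) (y 2))
            (EuclideanGeometry.angle (y 0) (y 1) (y 2)))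
          (EuclideanGeometry.angle (y 0) (y 2) (y 1)) ≤ γ₂) := by
  have hrange : ∀ y : Fin 3 → EuclideanSpace ℝ (Fin 2), Set.range y = {y 0, y 1, y 2} := by
    intro y
    ext x
    simp [Fin.exists_fin_succ, eq_comm]
  have hb : ∀ y ∈ 𝒮, _ := fun y hy => semiRegularityRatio_maxAngle_bounds
    (p := y 0) (q := y 1) (r := y 2) (by
      rw [← hrange, ← affineIndependent_iff_not_collinear]; exact h𝒮 y hy)
  simp only [hrange]
  change (∃ γ₀ > (0 : ℝ), ∀ y ∈ 𝒮, semiRegularityRatio (y 0) (y 1) (y 2) ≤ γ₀) ↔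
    ∃ γ₂ : ℝ, 0 < γ₂ ∧ γ₂ < Real.pi ∧ ∀ y ∈ 𝒮, maxAngle (y 0) (y 1) (y 2) ≤ γ₂
  have hpi := Real.pi_gt_three
  constructor
  · rintro ⟨γ, hγ, H⟩
    refine ⟨max 1 (Real.pi - 2 / γ), by positivity, ?_, fun y hy => le_max_of_le_right ?_⟩
    · rw [max_lt_iff]
      exact ⟨by linarith, sub_lt_self _ (by positivity)⟩
    · obtain ⟨h1, h2, h3, -⟩ := hb y hy
      have hsin := Real.sin_pos_of_pos_of_lt_pi (by linarith) h2
      have h4 := h3.trans (H y hy)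
      rw [div_le_comm₀ hsin hγ] at h4
      have h5 := Real.sin_lt (sub_pos.2 h2)
      rw [Real.sin_pi_sub] at h5
      linarith
  · rintro ⟨γ, hγ, hγπ, H⟩
    have hs : 0 < min (Real.sin (Real.pi / 3)) (Real.sin γ) :=
      lt_min (Real.sin_pos_of_pos_of_lt_pi (by linarith) (by linarith))
        (Real.sin_pos_of_pos_of_lt_pi hγ hγπ)
    refine ⟨4 / min (Real.sin (Real.pi / 3)) (Real.sin γ), by positivity, fun y hy => ?_⟩
    obtain ⟨h1, h2, -, h4⟩ := hb y hy
    refine h4.trans (div_le_div_of_nonneg_left (by norm_num) hs ?_)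
    exact strictConcaveOn_sin_Icc.concaveOn.min_le_of_mem_Icc ⟨by linarith, by linarith⟩
      ⟨hγ.le, hγπ.le⟩ ⟨h1, H y hy⟩
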